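/- Let k ≥ 1 and 0 < t ≤ 1. For a function g : (ℝ^n)^{m+1} → ℝ and s ∈ (0,1] write ∂_sΨ_{m,s}·g for the function y ↦ (deriv (u ↦ Ψ_{m,u}(y)) s)·g(y), and define K_{m,t} g : (ℝ^n)^{m+2} → ℝ by K_{m,t} g (x) := ∫_t^1 H_{m,s/2}(∂_sΨ_{m,s}·g)(x) ds. Then for every function f : (ℝ^n)^{k+1} → ℝ one has, pointwise on (ℝ^n)^{k+1}: b(K_{k,t} f) + K_{k−1,t}(b f) = Ψ_{k,1}·f − Ψ_{k,t}·f. -/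

import Mathlib

open scoped BigOperators
open MeasureTheory

noncomputable section

abbrev Euc (n : ℕ) : Type := EuclideanSpace ℝ (Fin n)

/-- The `i`-th simplicial face map `D_i : E^k → E^{k+1}`. -/
def face {n : ℕ} (k i : ℕ) (x : Fin k → Euc n) : Fin (k + 1) → Euc n :=
  fun l =>
    if _hle : (l : ℕ) ≤ i then
      if h : (l : ℕ) < k then x ⟨l, h⟩
      else if h0 : 0 < k then x ⟨0, h0⟩ else 0
    else x ⟨(l : ℕ) - 1, by have hl := l.isLt; omega⟩

/-- The Hochschild boundary `b f = ∑ (-1)^i f ∘ D_i`. -/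
def hb {n k : ℕ} (f : (Fin (k + 1) → Euc n) → ℝ) : (Fin k → Euc n) → ℝ :=
  fun x => ∑ i ∈ Finset.range (k + 1), (-1 : ℝ) ^ i * f (face k i x)

/-- Degeneracy `σ_i` omitting the `(i+1)`-st entry. -/
def degen {n : ℕ} (i : ℕ) {m : ℕ} (x : Fin (m + 1) → Euc n) : Fin m → Euc n :=
  fun l =>
    if (l : ℕ) ≤ i then x ⟨l, by have hl := l.isLt; omega⟩
    else x ⟨(l : ℕ) + 1, by have hl := l.isLt; omega⟩

/-- Squared distance of cyclically consecutive entries. -/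
def dsq {n m : ℕ} (x : Fin m → Euc n) (j : ℕ) : ℝ :=
  if hm : 0 < m then
    ‖x ⟨j % m, Nat.mod_lt _ hm⟩ - x ⟨(j + 1) % m, Nat.mod_lt _ hm⟩‖ ^ 2
  else 0

/-- Cutoff `Ψ` with `i` factors on `E^m`. -/
def Psi {n : ℕ} (ρ : ℝ → ℝ) (i : ℕ) (t : ℝ) {m : ℕ} (x : Fin m → Euc n) : ℝ :=
  ∏ j ∈ Finset.range i, ρ (dsq x j / t)

/-- `η_{m,i,t} g = Ψ_{m+1,i,t} · (g ∘ σ_{i-1})`. -/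
def eta {n : ℕ} (ρ : ℝ → ℝ) (i : ℕ) (t : ℝ) {m : ℕ} (g : (Fin m → Euc n) → ℝ) :
    (Fin (m + 1) → Euc n) → ℝ :=
  fun x => Psi ρ i t x * g (degen (i - 1) x)

/-- `H_{m,t} = ∑_{i=1}^{m+1} (-1)^{i+1} η_{m,i,t}`. -/
def Hmap {n : ℕ} (ρ : ℝ → ℝ) (t : ℝ) {m : ℕ} (g : (Fin m → Euc n) → ℝ) :
    (Fin (m + 1) → Euc n) → ℝ :=
  fun x => ∑ i ∈ Finset.Icc 1 m, (-1 : ℝ) ^ (i + 1) * eta ρ i t g x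

/-- `K_{m,t} g = ∫_t^1 H_{m,s/2}(∂_s Ψ_{m,s} · g) ds`. -/
def Kmap {n : ℕ} (ρ : ℝ → ℝ) (t : ℝ) {m : ℕ} (g : (Fin m → Euc n) → ℝ) :
    (Fin (m + 1) → Euc n) → ℝ :=
  fun x => ∫ s in t..(1 : ℝ), Hmap ρ (s / 2) (fun y => deriv (fun u => Psi ρ m u y) s * g y) x

/-- Standard basis vector in the `j`-th block, `l`-th coordinate. -/
def blockVec (n m j : ℕ) (l : Fin n) : Fin m → Euc n :=
  fun j' => if (j' : ℕ) = j then EuclideanSpace.single l 1 else 0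

/-- Iterated partial derivative `∂^α_j`. -/
def mpderiv {n m : ℕ} (j : ℕ) (α : Fin n → ℕ) (g : (Fin m → Euc n) → ℝ) :
    (Fin m → Euc n) → ℝ :=
  (List.finRange n).foldr
    (fun l gg => (fun h (x : Fin m → Euc n) => fderiv ℝ h x (blockVec n m j l))^[α l] gg) g

lemma dsq_of_lt {n m : ℕ} (x : Fin m → Euc n) {l : ℕ} (hl : l < m) :
    dsq x l = ‖x ⟨l, hl⟩ - (if h : l + 1 < m then x ⟨l + 1, h⟩ else x ⟨0, by omega⟩)‖ ^ 2 := by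
  have hm : 0 < m := by omega
  simp only [dsq, hm, dif_pos, Nat.mod_eq_of_lt hl]
  split_ifs with h
  · simp only [Nat.mod_eq_of_lt h]
  · obtain rfl : m = l + 1 := by omega
    simp only [Nat.mod_self]

lemma dsq_face_of_lt {n m : ℕ} (x : Fin m → Euc n) {j l : ℕ} (hl : l < j) (hj : j ≤ m) :
    dsq (face m j x) l = dsq x l := by
  rw [dsq_of_lt _ (show l < m + 1 by omega), dsq_of_lt _ (show l < m by omega)]
  have h1 : l < m := by omega
  have h2 : l ≤ j := by omega
  have h3 : l + 1 ≤ j := by omega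
  have h4 : 0 < m := by omega
  simp [face, h1, h2, h3, h4]

lemma dsq_face_self {n m : ℕ} (x : Fin m → Euc n) {j : ℕ} (hm : 0 < m) (hj : j ≤ m) :
    dsq (face m j x) j = 0 := by
  rw [dsq_of_lt _ (show j < m + 1 by omega)]
  rcases hj.lt_or_eq with h | rfl
  · simp [face, h]
  · simp [face, hm]

lemma dsq_face_succ {n m : ℕ} (x : Fin m → Euc n) {j l : ℕ} (hj : j ≤ l) (hl : l < m) :
    dsq (face m j x) (l + 1) = dsq x l := by
  rw [dsq_of_lt _ (show l + 1 < m + 1 by omega), dsq_of_lt _ hl]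
  have h1 : ¬ l + 1 ≤ j := by omega
  have h2 : ¬ l + 1 + 1 ≤ j := by omega
  have h3 : 0 < m := by omega
  simp [face, h1, h2, h3]

lemma degen_face_left {n m : ℕ} (x : Fin m → Euc n) (j : ℕ) :
    degen j (face m j x) = x := by
  funext l
  have := l.isLt
  simp only [degen, face]
  split_ifs <;> first | omega | rfl

lemma degen_face_right {n m : ℕ} (x : Fin m → Euc n) (j : ℕ) :
    degen j (face m (j + 1) x) = x := by
  funext l
  have := l.isLt
  simp only [degen, face]
  split_ifs <;> first | omega | rfl

lemma degen_face_of_lt {n k : ℕ} (x : Fin (k + 1) → Euc n) {i j : ℕ} (h : i < j) (hj : j ≤ k) :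
    degen i (face (k + 1) (j + 1) x) = face k j (degen i x) := by
  funext l
  have := l.isLt
  simp only [degen, face]
  split_ifs <;> first | omega | rfl | (congr 1; apply Fin.ext; simp only []; omega)

lemma degen_succ_face_of_le {n k : ℕ} (x : Fin (k + 1) → Euc n) {i j : ℕ} (h : j ≤ i)
    (hi : i < k) :
    degen (i + 1) (face (k + 1) j x) = face k j (degen i x) := by
  funext l
  have := l.isLt
  simp only [degen, face]
  split_ifs <;> first | omega | rfl | (congr 1; apply Fin.ext; simp only []; omega)

section PsiFace

variable {n m : ℕ} {ρ : ℝ → ℝ} {τ : ℝ} (x : Fin m → Euc n)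

lemma Psi_face_of_le {i j : ℕ} (hi : i ≤ j) (hj : j ≤ m) :
    Psi ρ i τ (face m j x) = Psi ρ i τ x := by
  refine Finset.prod_congr rfl fun l hl => ?_
  rw [dsq_face_of_lt x (by have := Finset.mem_range.1 hl; omega) hj]

lemma Psi_succ_face (hρ : ρ 0 = 1) {i j : ℕ} (hm : 0 < m) (hj : j ≤ i) (hi : i ≤ m) :
    Psi ρ (i + 1) τ (face m j x) = Psi ρ i τ x := by
  obtain ⟨r, rfl⟩ := Nat.exists_eq_add_of_le hj
  have hjm : j ≤ m := by omega
  unfold Psi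
  rw [show j + r + 1 = (j + 1) + r by ring, Finset.prod_range_add, Finset.prod_range_succ,
    Finset.prod_range_add, dsq_face_self x hm hjm, zero_div, hρ, mul_one]
  congr 1
  · exact Psi_face_of_le x le_rfl hjm
  · refine Finset.prod_congr rfl fun l hl => ?_
    have := Finset.mem_range.1 hl
    rw [show j + 1 + l = (j + l) + 1 by ring, dsq_face_succ x (by omega) (by omega)]

end PsiFace

lemma sum_range_of_eq_add_two_add (T : ℕ → ℝ) {N i r : ℕ} (hN : N = i + 2 + r) :
    ∑ j ∈ Finset.range N, T j =
      ∑ j ∈ Finset.range i, T j + T i + T (i + 1) + ∑ j ∈ Finset.range r, T (i + 2 + j) := by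
  rw [hN, Finset.sum_range_add, Finset.sum_range_succ, Finset.sum_range_succ]

lemma Hmap_eq_sum_range {n m : ℕ} (ρ : ℝ → ℝ) (τ : ℝ) (g : (Fin m → Euc n) → ℝ)
    (x : Fin (m + 1) → Euc n) :
    Hmap ρ τ g x = ∑ i ∈ Finset.range m, (-1 : ℝ) ^ i * (Psi ρ (i + 1) τ x * g (degen i x)) := by
  rw [Hmap, ← Finset.Ico_add_one_right_eq_Icc, Finset.sum_Ico_eq_sum_range]
  refine Finset.sum_congr (by simp) fun i _ => ?_
  simp only [eta, add_comm 1 i, Nat.add_sub_cancel]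
  ring

/-- `H` is a contracting homotopy up to the full cutoff. -/
lemma hb_Hmap_add_Hmap_hb {n k : ℕ} {ρ : ℝ → ℝ} (hρ : ρ 0 = 1) (τ : ℝ)
    (g : (Fin (k + 1) → Euc n) → ℝ) (x : Fin (k + 1) → Euc n) :
    hb (Hmap ρ τ g) x + Hmap ρ τ (hb g) x = (1 - Psi ρ (k + 1) τ x) * g x := by
  set P : ℕ → ℝ := fun i => Psi ρ i τ x with hP
  set G : ℕ → ℕ → ℝ := fun i j => (-1 : ℝ) ^ j * (P i * g (face k j (degen (i - 1) x))) with hG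
  set A : ℕ → ℝ := fun i => ∑ j ∈ Finset.range i, G i j with hA
  set S : ℕ → ℝ := fun i => ∑ j ∈ Finset.range (k + 1), G i j with hS
  have row : ∀ i ∈ Finset.range (k + 1),
      (-1 : ℝ) ^ i * ∑ j ∈ Finset.range (k + 1 + 1), (-1 : ℝ) ^ j *
        (Psi ρ (i + 1) τ (face (k + 1) j x) * g (degen i (face (k + 1) j x))) =
      ((-1 : ℝ) ^ i * A i - (-1 : ℝ) ^ (i + 1) * A (i + 1)) + (P i - P (i + 1)) * g x
        + (-1 : ℝ) ^ (i + 1) * S (i + 1) := by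
    intro i hi
    have hik : i ≤ k := Nat.lt_succ_iff.1 (Finset.mem_range.1 hi)
    obtain ⟨r, hr⟩ := Nat.exists_eq_add_of_le hik
    rw [sum_range_of_eq_add_two_add _ (show k + 1 + 1 = i + 2 + r by omega)]
    have h1 : ∑ j ∈ Finset.range i, (-1 : ℝ) ^ j *
        (Psi ρ (i + 1) τ (face (k + 1) j x) * g (degen i (face (k + 1) j x))) = A i := by
      refine Finset.sum_congr rfl fun j hj => ?_
      have hji := Finset.mem_range.1 hj
      obtain ⟨i, rfl⟩ : ∃ i', i = i' + 1 := ⟨i - 1, by omega⟩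
      rw [Psi_succ_face x hρ (by omega) (by omega) (by omega),
        degen_succ_face_of_le x (by omega) (by omega)]
      rfl
    have h2 : ∑ j ∈ Finset.range r, (-1 : ℝ) ^ (i + 2 + j) *
        (Psi ρ (i + 1) τ (face (k + 1) (i + 2 + j) x) *
          g (degen i (face (k + 1) (i + 2 + j) x))) = A (i + 1) - S (i + 1) := by
      have hSA : S (i + 1) = A (i + 1) + ∑ j ∈ Finset.range r, G (i + 1) (i + 1 + j) := by
        simp only [hS, hA]
        rw [show k + 1 = (i + 1) + r by omega, Finset.sum_range_add]
      rw [hSA, sub_add_cancel_left, ← Finset.sum_neg_distrib]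
      refine Finset.sum_congr rfl fun j hj => ?_
      have hjr := Finset.mem_range.1 hj
      rw [show i + 2 + j = (i + 1 + j) + 1 by ring, Psi_face_of_le x (by omega) (by omega),
        degen_face_of_lt x (by omega) (by omega)]
      simp only [hG, hP, Nat.add_sub_cancel]
      ring
    rw [h1, h2, degen_face_left, degen_face_right,
      Psi_succ_face x hρ (by omega) le_rfl (by omega), Psi_face_of_le x le_rfl (by omega)]
    have hsq : (-1 : ℝ) ^ i * (-1 : ℝ) ^ i = 1 := by rw [← mul_pow]; simp
    simp only [pow_succ, hP]
    linear_combination (Psi ρ i τ x - Psi ρ (i + 1) τ x) * g x * hsq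
  have hleft : hb (Hmap ρ τ g) x = (P 0 - P (k + 1)) * g x
      + ∑ i ∈ Finset.range k, (-1 : ℝ) ^ (i + 1) * S (i + 1) := by
    have swap : hb (Hmap ρ τ g) x = ∑ i ∈ Finset.range (k + 1), (-1 : ℝ) ^ i *
        ∑ j ∈ Finset.range (k + 1 + 1), (-1 : ℝ) ^ j *
          (Psi ρ (i + 1) τ (face (k + 1) j x) * g (degen i (face (k + 1) j x))) := by
      simp only [hb, Hmap_eq_sum_range, Finset.mul_sum]
      rw [Finset.sum_comm]
      exact Finset.sum_congr rfl fun i _ => Finset.sum_congr rfl fun j _ => by ring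
    rw [swap, Finset.sum_congr rfl row, Finset.sum_add_distrib, Finset.sum_add_distrib,
      Finset.sum_range_sub' (fun i => (-1 : ℝ) ^ i * A i), ← Finset.sum_mul,
      Finset.sum_range_sub' P, Finset.sum_range_succ _ k]
    have hA0 : A 0 = 0 := by simp [hA]
    have hAS : A (k + 1) = S (k + 1) := rfl
    rw [hA0, hAS]
    ring
  have hright : Hmap ρ τ (hb g) x = -∑ i ∈ Finset.range k, (-1 : ℝ) ^ (i + 1) * S (i + 1) := by
    rw [Hmap_eq_sum_range, ← Finset.sum_neg_distrib]
    refine Finset.sum_congr rfl fun i _ => ?_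
    have : S (i + 1) = Psi ρ (i + 1) τ x * hb g (degen i x) := by
      simp only [hS, hG, hb, Finset.mul_sum, Nat.add_sub_cancel, hP]
      exact Finset.sum_congr rfl fun j _ => by ring
    rw [this]
    ring
  rw [hleft, hright]
  simp [hP, Psi]

section Analysis

variable {n m : ℕ} {ρ : ℝ → ℝ}

lemma contDiffOn_Psi (hρ : ContDiff ℝ (⊤ : ℕ∞) ρ) (i : ℕ) (y : Fin m → Euc n) :
    ContDiffOn ℝ (⊤ : ℕ∞) (fun u => Psi ρ i u y) (Set.Ioi 0) := by
  unfold Psi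
  refine contDiffOn_prod fun j _ => hρ.comp_contDiffOn ?_
  exact contDiffOn_const.div contDiffOn_id fun u hu => (Set.mem_Ioi.1 hu).ne'

lemma continuousOn_deriv_Psi (hρ : ContDiff ℝ (⊤ : ℕ∞) ρ) (i : ℕ) (y : Fin m → Euc n) :
    ContinuousOn (deriv fun u => Psi ρ i u y) (Set.Ioi 0) :=
  (contDiffOn_Psi hρ i y).continuousOn_deriv_of_isOpen isOpen_Ioi (by simp)

lemma continuousOn_Hmap_deriv_Psi (hρ : ContDiff ℝ (⊤ : ℕ∞) ρ) (g : (Fin m → Euc n) → ℝ)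
    (x : Fin (m + 1) → Euc n) :
    ContinuousOn
      (fun s => Hmap ρ (s / 2) (fun y => deriv (fun u => Psi ρ m u y) s * g y) x)
      (Set.Ioi 0) := by
  simp only [Hmap_eq_sum_range]
  refine continuousOn_finsetSum _ fun i _ => continuousOn_const.mul (ContinuousOn.mul ?_ ?_)
  · refine (contDiffOn_Psi hρ (i + 1) x).continuousOn.comp
      (continuousOn_id.div_const 2) fun s hs => ?_
    exact half_pos (Set.mem_Ioi.1 hs)
  · exact (continuousOn_deriv_Psi hρ m _).mul continuousOn_const

lemma Psi_half_mul_deriv_Psi (hρone : ∀ r : ℝ, r ≤ 1 / 3 → ρ r = 1)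
    (hρzero : ∀ r : ℝ, 1 / 2 < r → ρ r = 0) (i : ℕ) {s : ℝ} (hs : 0 < s) (y : Fin m → Euc n) :
    Psi ρ i (s / 2) y * deriv (fun u => Psi ρ i u y) s = 0 := by
  by_cases h : ∃ j ∈ Finset.range i, 1 / 2 < dsq y j / (s / 2)
  · obtain ⟨j, hj, hlt⟩ := h
    rw [Psi, Finset.prod_eq_zero hj (hρzero _ hlt), zero_mul]
  · push Not at h
    have hev : (fun u => Psi ρ i u y) =ᶠ[nhds s] fun _ => 1 := by
      filter_upwards [lt_mem_nhds (show 3 * s / 4 < s by linarith)] with u hu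
      refine Finset.prod_eq_one fun j hj => hρone _ ?_
      have := h j hj
      rw [div_le_iff₀ (by linarith)] at this ⊢
      linarith
    rw [hev.deriv_eq, deriv_const, mul_zero]

lemma hb_deriv_Psi_mul {k : ℕ} (hρ : ρ 0 = 1) (hk : 0 < k) (s : ℝ)
    (f : (Fin (k + 1) → Euc n) → ℝ) :
    hb (fun y => deriv (fun u => Psi ρ (k + 1) u y) s * f y) =
      fun z => deriv (fun u => Psi ρ k u z) s * hb f z := by
  funext z
  simp only [hb, Finset.mul_sum]
  refine Finset.sum_congr rfl fun j hj => ?_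
  have hjk : j ≤ k := Nat.lt_succ_iff.1 (Finset.mem_range.1 hj)
  simp only [Psi_succ_face z hρ hk hjk le_rfl]
  ring

end Analysis

theorem stmt16 {n : ℕ} (hn : 1 ≤ n)
    (ρ : ℝ → ℝ) (hρsmooth : ContDiff ℝ (⊤ : ℕ∞) ρ)
    (hρ0 : ∀ r : ℝ, 0 ≤ ρ r) (hρ1 : ∀ r : ℝ, ρ r ≤ 1)
    (hρone : ∀ r : ℝ, r ≤ 1 / 3 → ρ r = 1) (hρzero : ∀ r : ℝ, 1 / 2 < r → ρ r = 0)
    {k : ℕ} (hk : 1 ≤ k) (t : ℝ) (ht : 0 < t) (ht1 : t ≤ 1)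
    (f : (Fin (k + 1) → Euc n) → ℝ) (x : Fin (k + 1) → Euc n) :
    hb (Kmap ρ t f) x + Kmap ρ t (hb f) x
      = Psi ρ (k + 1) 1 x * f x - Psi ρ (k + 1) t x * f x := by
  have hρ : ρ 0 = 1 := hρone 0 (by norm_num)
  have hsub : Set.uIcc t 1 ⊆ Set.Ioi 0 := by
    rw [Set.uIcc_of_le ht1]
    exact fun s hs => ht.trans_le hs.1
  have hint : ∀ {m : ℕ} (g : (Fin m → Euc n) → ℝ) (y : Fin (m + 1) → Euc n),
      IntervalIntegrable
        (fun s => Hmap ρ (s / 2) (fun y => deriv (fun u => Psi ρ m u y) s * g y) y) volume t 1 :=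
    fun g y => ((continuousOn_Hmap_deriv_Psi hρsmooth g y).mono hsub).intervalIntegrable
  have hkey : ∀ s ∈ Set.uIcc t 1,
      hb (Hmap ρ (s / 2) fun y => deriv (fun u => Psi ρ (k + 1) u y) s * f y) x
        + Hmap ρ (s / 2) (fun z => deriv (fun u => Psi ρ k u z) s * hb f z) x
      = deriv (fun u => Psi ρ (k + 1) u x) s * f x := by
    intro s hs
    rw [← hb_deriv_Psi_mul hρ hk, hb_Hmap_add_Hmap_hb hρ]
    linear_combination -f x * Psi_half_mul_deriv_Psi hρone hρzero (k + 1) (hsub hs) x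
  have hftc : ∫ s in t..1, deriv (fun u => Psi ρ (k + 1) u x) s
      = Psi ρ (k + 1) 1 x - Psi ρ (k + 1) t x := by
    refine intervalIntegral.integral_deriv_eq_sub (f := fun u => Psi ρ (k + 1) u x) ?_
      ((continuousOn_deriv_Psi hρsmooth (k + 1) x).mono hsub).intervalIntegrable
    intro s hs
    exact ((contDiffOn_Psi hρsmooth (k + 1) x).contDiffAt
      (Ioi_mem_nhds (hsub hs))).differentiableAt (by simp)
  have hbK : hb (Kmap ρ t f) x = ∫ s in t..1,
      hb (Hmap ρ (s / 2) fun y => deriv (fun u => Psi ρ (k + 1) u y) s * f y) x := by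
    simp only [hb, Kmap]
    rw [intervalIntegral.integral_finsetSum fun i _ => (hint f _).const_mul _]
    simp only [intervalIntegral.integral_const_mul]
  have hbint : IntervalIntegrable (fun s =>
      hb (Hmap ρ (s / 2) fun y => deriv (fun u => Psi ρ (k + 1) u y) s * f y) x) volume t 1 := by
    have := IntervalIntegrable.sum (Finset.range (k + 1 + 1))
      (f := fun i s => (-1 : ℝ) ^ i * Hmap ρ (s / 2)
        (fun y => deriv (fun u => Psi ρ (k + 1) u y) s * f y) (face (k + 1) i x))
      (μ := volume) (a := t) (b := 1) fun i _ => (hint f _).const_mul _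
    simpa only [hb, Finset.sum_fn] using this
  rw [hbK, Kmap, ← intervalIntegral.integral_add hbint (hint (hb f) x),
    intervalIntegral.integral_congr hkey, intervalIntegral.integral_mul_const, hftc, sub_mul]
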